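/- Let H be a real Hilbert space and C a nonempty closed convex subset of H. Let f_1,…,f_L : C × C → ℝ be bifunctions satisfying conditions (A1)–(A4), let (T_n)_{n≥1} be a sequence of nonexpansive maps from C to H, and let Γ be a family of closed generalized nonexpansive maps from C to H such that ⋂_{n≥1} F(T_n) = F(Γ) ≠ ∅, where F(Γ) is the set of common fixed points of Γ, and such that (T_n) satisfies the NST-condition with Γ. Assume B := F(Γ) ∩ (⋂_{l=1}^{L} EP(f_l)) ≠ ∅. Fix α₁, α₂, α₃ ∈ (0,1) with α₁+α₂+α₃ = 1, a > 0 and real numbers r_n ≥ a. Define the sequence (x_n) by: x₁ = x ∈ C, C₁ = C, and for n ≥ 1: z_n is the point of C satisfying f_{n mod L}(z_n, y) + (1/r_n)⟨y − z_n, z_n − x_n⟩ ≥ 0 for all y ∈ C; y_n = α₁x_n + α₂z_n + α₃T_n x_n; C_{n+1} = {z ∈ C_n : ‖z − y_n‖ ≤ ‖z − x_n‖}; and x_{n+1} = P_{C_{n+1}} x. Then B is a nonempty closed convex set and (x_n) converges strongly to P_B x. -/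

import Mathlib

open scoped RealInnerProductSpace

open Filter Topology

section HalfSpace

variable {E : Type*} [NormedAddCommGroup E]

theorem isClosed_setOf_norm_sub_le_norm_sub (u v : E) :
    IsClosed {z : E | ‖z - u‖ ≤ ‖z - v‖} :=
  isClosed_le (by fun_prop) (by fun_prop)

/-- The fixed point set of a nonexpansive map is an intersection of half-spaces with its domain. -/
theorem setOf_fixed_eq_iInter {C : Set E} {T : E → E}
    (hT : ∀ u ∈ C, ∀ v ∈ C, ‖T u - T v‖ ≤ ‖u - v‖) :
    {p ∈ C | T p = p} = C ∩ ⋂ w ∈ C, {p | ‖p - T w‖ ≤ ‖p - w‖} := by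
  ext p
  simp only [Set.mem_ofPred_eq, Set.mem_inter_iff, Set.mem_iInter]
  refine and_congr_right fun hp => ⟨fun h w hw => ?_, fun h => ?_⟩
  · simpa only [h] using hT p hp w hw
  · have := h p hp
    rw [sub_self, norm_zero, norm_le_zero_iff, sub_eq_zero] at this
    exact this.symm

theorem isClosed_setOf_fixed {C : Set E} {T : E → E} (hC : IsClosed C)
    (hT : ∀ u ∈ C, ∀ v ∈ C, ‖T u - T v‖ ≤ ‖u - v‖) : IsClosed {p ∈ C | T p = p} := by
  rw [setOf_fixed_eq_iInter hT]
  exact hC.inter (isClosed_biInter fun w _ => isClosed_setOf_norm_sub_le_norm_sub _ _)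

variable [InnerProductSpace ℝ E]

theorem norm_sub_le_norm_sub_iff_inner_le (u v z : E) :
    ‖z - u‖ ≤ ‖z - v‖ ↔ ⟪2 • (v - u), z⟫ ≤ ‖v‖ ^ 2 - ‖u‖ ^ 2 := by
  rw [← sq_le_sq₀ (norm_nonneg _) (norm_nonneg _), norm_sub_sq_real, norm_sub_sq_real,
    two_smul, inner_add_left, inner_sub_left, real_inner_comm z u, real_inner_comm z v]
  constructor <;> intro h <;> linarith

theorem convex_setOf_norm_sub_le_norm_sub (u v : E) :
    Convex ℝ {z : E | ‖z - u‖ ≤ ‖z - v‖} := by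
  simp only [norm_sub_le_norm_sub_iff_inner_le]
  exact convex_halfSpace_le (innerₛₗ ℝ (2 • (v - u))).isLinear _

theorem convex_setOf_fixed {C : Set E} {T : E → E} (hC : Convex ℝ C)
    (hT : ∀ u ∈ C, ∀ v ∈ C, ‖T u - T v‖ ≤ ‖u - v‖) : Convex ℝ {p ∈ C | T p = p} := by
  rw [setOf_fixed_eq_iInter hT]
  exact hC.inter (convex_iInter₂ fun w _ => convex_setOf_norm_sub_le_norm_sub _ _)

end HalfSpace

section Equilibrium

theorem LowerSemicontinuousOn.isClosed_sublevel {X : Type*} [TopologicalSpace X] {C : Set X}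
    {g : X → ℝ} (hg : LowerSemicontinuousOn g C) (hC : IsClosed C) (c : ℝ) :
    IsClosed {p ∈ C | g p ≤ c} := by
  obtain ⟨v, hv, h⟩ := lowerSemicontinuousOn_iff_preimage_Iic.1 hg c
  change IsClosed (C ∩ g ⁻¹' Set.Iic c)
  exact h ▸ hC.inter hv

variable {E : Type*} [NormedAddCommGroup E] [NormedSpace ℝ E]

/-- Minty's lemma for monotone bifunctions: the equilibrium problem and its dual have the same
solutions. -/
theorem setOf_equilibrium_eq_setOf_dual {C : Set E} {f : E → E → ℝ} (hC : Convex ℝ C)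
    (hf1 : ∀ x ∈ C, f x x = 0) (hf2 : ∀ x ∈ C, ∀ y ∈ C, f x y + f y x ≤ 0)
    (hf3 : ∀ x ∈ C, ∀ y ∈ C, ∀ z ∈ C,
      limsup (fun t : ℝ => f (t • z + (1 - t) • x) y) (𝓝[>] 0) ≤ f x y)
    (hf4 : ∀ x ∈ C, ConvexOn ℝ C (f x)) :
    {p ∈ C | ∀ y ∈ C, 0 ≤ f p y} = C ∩ ⋂ y ∈ C, {p ∈ C | f y p ≤ 0} := by
  ext p
  simp only [Set.mem_ofPred_eq, Set.mem_inter_iff, Set.mem_iInter]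
  refine and_congr_right fun hp => ⟨fun h y hy => ⟨hp, ?_⟩, fun h y hy => ?_⟩
  · linarith [hf2 p hp y hy, h y hy]
  · refine le_trans ?_ (hf3 p hp y hy y hy)
    have key : ∀ᶠ t : ℝ in 𝓝[>] 0, 0 ≤ f (t • y + (1 - t) • p) y := by
      filter_upwards [Ioo_mem_nhdsGT one_pos] with t ht
      have ht' : 0 ≤ 1 - t := by linarith [ht.2]
      have hw : t • y + (1 - t) • p ∈ C := hC hy hp ht.1.le ht' (by ring)
      have hconv := (hf4 _ hw).2 hy hp ht.1.le ht' (by ring)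
      rw [hf1 _ hw, smul_eq_mul, smul_eq_mul] at hconv
      have := mul_nonpos_of_nonneg_of_nonpos ht' (h _ hw).2
      exact nonneg_of_mul_nonneg_right (by linarith) ht.1
    rw [limsup_eq]
    refine Real.sInf_nonneg fun b hb => ?_
    obtain ⟨t, ht, htb⟩ := (key.and hb).exists
    exact ht.trans htb

end Equilibrium

section Projection

variable {E : Type*} [NormedAddCommGroup E] [InnerProductSpace ℝ E]

theorem norm_sub_sq_le_of_forall_norm_le {K : Set E} (hK : Convex ℝ K) {x v w : E} (hv : v ∈ K)
    (hmin : ∀ w ∈ K, ‖x - v‖ ≤ ‖x - w‖) (hw : w ∈ K) :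
    ‖w - v‖ ^ 2 ≤ ‖x - w‖ ^ 2 - ‖x - v‖ ^ 2 := by
  have : Nonempty K := ⟨⟨v, hv⟩⟩
  have hinf : ‖x - v‖ = ⨅ w : K, ‖x - w‖ :=
    le_antisymm (le_ciInf fun w => hmin w w.2)
      (ciInf_le ⟨0, by rintro _ ⟨w, rfl⟩; exact norm_nonneg _⟩ (⟨v, hv⟩ : K))
  have h := (norm_eq_iInf_iff_real_inner_le_zero hK hv).1 hinf w hw
  have h2 := norm_sub_sq_real (x - v) (w - v)
  rw [sub_sub_sub_cancel_right] at h2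
  linarith

/-- Successive nearest points to `x` in a decreasing sequence of convex sets with a common point
form a Cauchy sequence. -/
theorem cauchySeq_of_forall_norm_le {K : ℕ → Set E} (hK : ∀ n, Convex ℝ (K n)) (hanti : Antitone K)
    {x p : E} {u : ℕ → E} (hp : ∀ n, p ∈ K n) (hu : ∀ n, u n ∈ K n)
    (hmin : ∀ n, ∀ w ∈ K n, ‖x - u n‖ ≤ ‖x - w‖) : CauchySeq u := by
  have hmono : Monotone fun n => ‖x - u n‖ := fun n m hnm => hmin n _ (hanti hnm (hu m))
  have hbdd : BddAbove (Set.range fun n => ‖x - u n‖) :=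
    ⟨‖x - p‖, by rintro _ ⟨n, rfl⟩; exact hmin n p (hp n)⟩
  have hlim := tendsto_atTop_ciSup hmono hbdd
  set D := ⨆ n, ‖x - u n‖
  refine cauchySeq_of_le_tendsto_0' (fun n => √(D ^ 2 - ‖x - u n‖ ^ 2)) (fun n m hnm => ?_) ?_
  · refine Real.le_sqrt_of_sq_le ?_
    rw [dist_comm, dist_eq_norm]
    refine (norm_sub_sq_le_of_forall_norm_le (hK n) (hu n) (hmin n) (hanti hnm (hu m))).trans ?_
    have : ‖x - u m‖ ≤ D := le_ciSup hbdd m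
    gcongr
  · have h := ((hlim.pow 2).const_sub (D ^ 2)).sqrt
    rwa [sub_self, Real.sqrt_zero] at h

/-- The three-point convexity identity for the squared norm. -/
theorem norm_add_add_smul_sq {a b c : ℝ} (h : a + b + c = 1) (u v w : E) :
    ‖a • u + b • v + c • w‖ ^ 2 = a * ‖u‖ ^ 2 + b * ‖v‖ ^ 2 + c * ‖w‖ ^ 2
      - a * b * ‖u - v‖ ^ 2 - a * c * ‖u - w‖ ^ 2 - b * c * ‖v - w‖ ^ 2 := by
  obtain rfl : a = 1 - b - c := by linarith
  simp only [← real_inner_self_eq_norm_sq, inner_add_left, inner_add_right, inner_sub_left,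
    inner_sub_right, real_inner_smul_left, real_inner_smul_right]
  rw [real_inner_comm u v, real_inner_comm u w, real_inner_comm v w]
  ring

/-- The resolvent inequality for a monotone bifunction. -/
theorem norm_sub_sq_le_of_resolvent {C : Set E} {f : E → E → ℝ}
    (hf2 : ∀ x ∈ C, ∀ y ∈ C, f x y + f y x ≤ 0) {r : ℝ} (hr : 0 < r) {x z p : E} (hz : z ∈ C)
    (hres : ∀ y ∈ C, 0 ≤ f z y + (1 / r) * ⟪y - z, z - x⟫)
    (hp : p ∈ C) (hfp : ∀ y ∈ C, 0 ≤ f p y) :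
    ‖z - p‖ ^ 2 ≤ ‖x - p‖ ^ 2 - ‖x - z‖ ^ 2 := by
  have h1 : 0 ≤ (1 / r) * ⟪p - z, z - x⟫ := by
    linarith [hres p hp, hf2 z hz p hp, hfp z hz]
  have h2 : 0 ≤ ⟪p - z, z - x⟫ := nonneg_of_mul_nonneg_right h1 (by positivity)
  have h3 := norm_add_sq_real (p - z) (z - x)
  rw [sub_add_sub_cancel, norm_sub_rev p x, norm_sub_rev p z, norm_sub_rev z x] at h3
  linarith

/-- Limits of resolvent iterates whose displacement vanishes solve the dual equilibrium problem. -/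
theorem apply_le_zero_of_tendsto_resolvent {C : Set E} {f : E → E → ℝ} (hC : IsClosed C)
    (hf2 : ∀ x ∈ C, ∀ y ∈ C, f x y + f y x ≤ 0) {y : E} (hy : y ∈ C)
    (hlsc : LowerSemicontinuousOn (f y) C) {a : ℝ} (ha : 0 < a) {r : ℕ → ℝ} (hr : ∀ n, a ≤ r n)
    {x z : ℕ → E} {q : E} (hz : ∀ n, z n ∈ C)
    (hres : ∀ n, 0 ≤ f (z n) y + (1 / r n) * ⟪y - z n, z n - x n⟫)
    (hzq : Tendsto z atTop (𝓝 q)) (hxz : Tendsto (fun n => ‖x n - z n‖) atTop (𝓝 0)) :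
    f y q ≤ 0 := by
  have hlim : Tendsto (fun n => (1 / a) * (‖y - z n‖ * ‖x n - z n‖)) atTop (𝓝 0) := by
    simpa using ((tendsto_const_nhds.sub hzq).norm.mul hxz).const_mul (1 / a)
  refine le_of_forall_pos_le_add fun ε hε => ?_
  rw [zero_add]
  refine ((hlsc.isClosed_sublevel hC ε).mem_of_tendsto hzq ?_).2
  filter_upwards [hlim.eventually (gt_mem_nhds hε)] with n hn
  refine ⟨hz n, le_trans ?_ hn.le⟩
  have hin : (1 / r n) * ⟪y - z n, z n - x n⟫ ≤ (1 / a) * (‖y - z n‖ * ‖x n - z n‖) := by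
    rw [norm_sub_rev (x n)]
    have hrn : 0 < r n := ha.trans_le (hr n)
    calc (1 / r n) * ⟪y - z n, z n - x n⟫
        ≤ (1 / r n) * (‖y - z n‖ * ‖z n - x n‖) := by
          gcongr
          exact real_inner_le_norm _ _
      _ ≤ _ := by
          gcongr
          exact hr n
  linarith [hres n, hf2 y hy (z n) (hz n)]

end Projection

/-- Hilbert-space case of Corollary 4.2 of the paper; indices relabelled to
start at `0`: for bifunctions `f₁, …, f_L` satisfying (A1)–(A4), a sequence `(Tₙ)` of
nonexpansive maps and a family `Γ` of closed generalized nonexpansive maps with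
`⋂ₙ F(Tₙ) = F(Γ) ≠ ∅` and `(Tₙ)` satisfying the NST-condition with `Γ`, if
`B := F(Γ) ∩ (⋂ₗ EP(fₗ)) ≠ ∅` then `B` is closed and convex and the hybrid sequence (with the
variational-inequality operators set to zero, so `uₙ = xₙ`) converges strongly to `P_B x`. -/
theorem statement19 (H : Type*) [NormedAddCommGroup H] [InnerProductSpace ℝ H] [CompleteSpace H]
    (C : Set H) (hCne : C.Nonempty) (hCclosed : IsClosed C) (hCconv : Convex ℝ C)
    (L : ℕ) (hL : 0 < L)
    (f : Fin L → H → H → ℝ)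
    (hA1 : ∀ l, ∀ x ∈ C, f l x x = 0)
    (hA2 : ∀ l, ∀ x ∈ C, ∀ y ∈ C, f l x y + f l y x ≤ 0)
    (hA3 : ∀ l, ∀ x ∈ C, ∀ y ∈ C, ∀ z ∈ C,
      Filter.limsup (fun t : ℝ => f l (t • z + (1 - t) • x) y) (nhdsWithin 0 (Set.Ioi 0))
        ≤ f l x y)
    (hA4 : ∀ l, ∀ x ∈ C, ConvexOn ℝ C (f l x) ∧ LowerSemicontinuousOn (f l x) C)
    (T : ℕ → H → H)
    (hTnonexp : ∀ n, ∀ u ∈ C, ∀ v ∈ C, ‖T n u - T n v‖ ≤ ‖u - v‖)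
    (Γ : Set (H → H))
    -- each member of Γ is generalized nonexpansive:
    (hΓgen : ∀ S ∈ Γ, {p ∈ C | S p = p}.Nonempty ∧
      ∀ w ∈ C, ∀ p ∈ {p ∈ C | S p = p}, ‖S w - p‖ ≤ ‖w - p‖)
    -- each member of Γ is a closed map:
    (hΓclosed : ∀ S ∈ Γ, ∀ u : ℕ → H, (∀ n, u n ∈ C) → ∀ p ∈ C,
      Filter.Tendsto u Filter.atTop (nhds p) →
      ∀ q : H, Filter.Tendsto (fun n => S (u n)) Filter.atTop (nhds q) → S p = q)
    (FΓ : Set H) (hFΓ : FΓ = {p ∈ C | ∀ S ∈ Γ, S p = p})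
    (hcommon : (⋂ n, {p ∈ C | T n p = p}) = FΓ) (hFΓne : FΓ.Nonempty)
    -- NST-condition of (Tₙ) with Γ:
    (hNST : ∀ u : ℕ → H, (∀ n, u n ∈ C) → Bornology.IsBounded (Set.range u) →
      Filter.Tendsto (fun n => ‖u n - T n (u n)‖) Filter.atTop (nhds 0) →
      ∀ S ∈ Γ, Filter.Tendsto (fun n => ‖u n - S (u n)‖) Filter.atTop (nhds 0))
    (B : Set H)
    (hB : B = FΓ ∩ (⋂ l, {p ∈ C | ∀ y ∈ C, 0 ≤ f l p y}))
    (hBne : B.Nonempty)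
    (α₁ α₂ α₃ : ℝ)
    (hα₁ : α₁ ∈ Set.Ioo (0 : ℝ) 1) (hα₂ : α₂ ∈ Set.Ioo (0 : ℝ) 1)
    (hα₃ : α₃ ∈ Set.Ioo (0 : ℝ) 1) (hαsum : α₁ + α₂ + α₃ = 1)
    (a : ℝ) (ha : 0 < a) (rn : ℕ → ℝ) (hrn : ∀ n, a ≤ rn n)
    (x : H) (hx : x ∈ C)
    (xseq zseq yseq : ℕ → H) (Cset : ℕ → Set H)
    (hx0 : xseq 0 = x) (hC0 : Cset 0 = C)
    (hzseq : ∀ n, zseq n ∈ C ∧ ∀ y ∈ C,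
      0 ≤ f ⟨n % L, Nat.mod_lt n hL⟩ (zseq n) y +
        (1 / rn n) * ⟪y - zseq n, zseq n - xseq n⟫)
    (hyseq : ∀ n, yseq n = α₁ • xseq n + α₂ • zseq n + α₃ • T n (xseq n))
    (hCrec : ∀ n, Cset (n + 1) = {z ∈ Cset n | ‖z - yseq n‖ ≤ ‖z - xseq n‖})
    -- xₙ₊₁ = P_{Cₙ₊₁} x :
    (hxnext : ∀ n, xseq (n + 1) ∈ Cset (n + 1) ∧
      ∀ w ∈ Cset (n + 1), ‖x - xseq (n + 1)‖ ≤ ‖x - w‖) :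
    (IsClosed B ∧ Convex ℝ B) ∧
      ∃ p : H, p ∈ B ∧ (∀ w ∈ B, ‖x - p‖ ≤ ‖x - w‖) ∧
        Filter.Tendsto xseq Filter.atTop (nhds p) := by
  have hEPdual := fun l => setOf_equilibrium_eq_setOf_dual hCconv (hA1 l) (hA2 l) (hA3 l)
    fun x hx => (hA4 l x hx).1
  have hBclosed : IsClosed B := by
    rw [hB, ← hcommon]
    refine (isClosed_iInter fun n => isClosed_setOf_fixed hCclosed (hTnonexp n)).inter
      (isClosed_iInter fun l => ?_)
    rw [hEPdual l]
    exact hCclosed.inter (isClosed_biInter fun y hy => (hA4 l y hy).2.isClosed_sublevel hCclosed 0)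
  have hBconv : Convex ℝ B := by
    rw [hB, ← hcommon]
    refine (convex_iInter fun n => convex_setOf_fixed hCconv (hTnonexp n)).inter
      (convex_iInter fun l => ?_)
    rw [hEPdual l]
    exact hCconv.inter (convex_iInter₂ fun y hy => (hA4 l y hy).1.convex_le 0)
  have hanti : Antitone Cset := antitone_nat_of_succ_le fun n => by
    rw [hCrec n]
    exact Set.sep_subset _ _
  have hCsub : ∀ n, Cset n ⊆ C := fun n => hC0 ▸ hanti (Nat.zero_le n)
  have hCsetconv : ∀ n, Convex ℝ (Cset n) := by
    intro n
    induction n with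
    | zero => rwa [hC0]
    | succ n ih =>
      rw [hCrec n]
      exact ih.inter (convex_setOf_norm_sub_le_norm_sub _ _)
  have hxmem : ∀ n, xseq n ∈ Cset n := by
    rintro (_ | n)
    · rwa [hx0, hC0]
    · exact (hxnext n).1
  have hxC : ∀ n, xseq n ∈ C := fun n => hCsub n (hxmem n)
  have hxmin : ∀ n, ∀ w ∈ Cset n, ‖x - xseq n‖ ≤ ‖x - w‖ := by
    rintro (_ | n)
    · intro w _
      simp [hx0]
    · exact (hxnext n).2
  have hBfix : ∀ p ∈ B, p ∈ C ∧ ∀ n, T n p = p := by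
    intro p hp
    rw [hB, ← hcommon] at hp
    have h := Set.mem_iInter.1 hp.1
    exact ⟨(h 0).1, fun n => (h n).2⟩
  have hBEP : ∀ p ∈ B, ∀ l, ∀ y ∈ C, 0 ≤ f l p y := by
    intro p hp l
    rw [hB] at hp
    exact (Set.mem_iInter.1 hp.2 l).2
  have hstep : ∀ p ∈ B, ∀ n, ‖yseq n - p‖ ^ 2 + α₁ * α₂ * ‖xseq n - zseq n‖ ^ 2
      + α₁ * α₃ * ‖xseq n - T n (xseq n)‖ ^ 2 ≤ ‖xseq n - p‖ ^ 2 := by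
    intro p hp n
    obtain ⟨hpC, hpT⟩ := hBfix p hp
    have hz := norm_sub_sq_le_of_resolvent (hA2 ⟨n % L, Nat.mod_lt n hL⟩)
      (ha.trans_le (hrn n)) (hzseq n).1 (hzseq n).2 hpC (hBEP p hp _)
    have hz' : ‖zseq n - p‖ ^ 2 ≤ ‖xseq n - p‖ ^ 2 := by
      linarith [sq_nonneg ‖xseq n - zseq n‖]
    have hT : ‖T n (xseq n) - p‖ ^ 2 ≤ ‖xseq n - p‖ ^ 2 := by
      have := hTnonexp n _ (hxC n) p hpC
      rw [hpT n] at this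
      gcongr
    have hy : yseq n - p = α₁ • (xseq n - p) + α₂ • (zseq n - p) + α₃ • (T n (xseq n) - p) := by
      obtain rfl : α₁ = 1 - α₂ - α₃ := by linarith
      rw [hyseq n]
      module
    have hid := norm_add_add_smul_sq hαsum (xseq n - p) (zseq n - p) (T n (xseq n) - p)
    rw [← hy] at hid
    simp only [sub_sub_sub_cancel_right] at hid
    have h2 := mul_le_mul_of_nonneg_left hz' hα₂.1.le
    have h3 := mul_le_mul_of_nonneg_left hT hα₃.1.le
    have h4 : 0 ≤ α₂ * α₃ * ‖zseq n - T n (xseq n)‖ ^ 2 :=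
      mul_nonneg (mul_nonneg hα₂.1.le hα₃.1.le) (sq_nonneg _)
    have h5 : ‖xseq n - p‖ ^ 2
        = α₁ * ‖xseq n - p‖ ^ 2 + α₂ * ‖xseq n - p‖ ^ 2 + α₃ * ‖xseq n - p‖ ^ 2 := by
      rw [← add_mul, ← add_mul, hαsum, one_mul]
    linarith
  have h12 : 0 < α₁ * α₂ := mul_pos hα₁.1 hα₂.1
  have h13 : 0 < α₁ * α₃ := mul_pos hα₁.1 hα₃.1
  have hBsub : ∀ n, B ⊆ Cset n := by
    intro n
    induction n with
    | zero => exact fun p hp => hC0 ▸ (hBfix p hp).1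
    | succ n ih =>
      intro p hp
      rw [hCrec n]
      refine ⟨ih hp, ?_⟩
      rw [norm_sub_rev p, norm_sub_rev p, ← sq_le_sq₀ (norm_nonneg _) (norm_nonneg _)]
      have := hstep p hp n
      have h1 := mul_nonneg h12.le (sq_nonneg ‖xseq n - zseq n‖)
      have h2 := mul_nonneg h13.le (sq_nonneg ‖xseq n - T n (xseq n)‖)
      linarith
  obtain ⟨p₀, hp₀⟩ := hBne
  obtain ⟨q, hq⟩ := cauchySeq_tendsto_of_complete
    (cauchySeq_of_forall_norm_le hCsetconv hanti (fun n => hBsub n hp₀) hxmem hxmin)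
  have hqC : q ∈ C := hCclosed.mem_of_tendsto hq (Eventually.of_forall hxC)
  have hyq : Tendsto yseq atTop (𝓝 q) := by
    have hq1 : Tendsto (fun n => xseq (n + 1)) atTop (𝓝 q) := (tendsto_add_atTop_iff_nat 1).2 hq
    have h0 : Tendsto (fun n => xseq (n + 1) - yseq n) atTop (𝓝 0) := by
      refine squeeze_zero_norm (a := fun n => ‖xseq (n + 1) - xseq n‖) (fun n => ?_)
        (by simpa using (hq1.sub hq).norm)
      have h := hxmem (n + 1)
      rw [hCrec n] at h
      exact h.2
    simpa using hq1.sub h0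
  have hgap : Tendsto (fun n => ‖xseq n - p₀‖ ^ 2 - ‖yseq n - p₀‖ ^ 2) atTop (𝓝 0) := by
    simpa using ((hq.sub_const p₀).norm.pow 2).sub ((hyq.sub_const p₀).norm.pow 2)
  have hvanish : ∀ (c : ℝ), 0 < c → ∀ u : ℕ → H,
      (∀ n, c * ‖u n‖ ^ 2 ≤ ‖xseq n - p₀‖ ^ 2 - ‖yseq n - p₀‖ ^ 2) →
      Tendsto (fun n => ‖u n‖) atTop (𝓝 0) := by
    intro c hc u hu
    refine squeeze_zero (fun n => norm_nonneg _) (fun n => Real.le_sqrt_of_sq_le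
      ((le_div_iff₀' hc).2 (hu n))) ?_
    simpa using (hgap.div_const c).sqrt
  have hxz : Tendsto (fun n => ‖xseq n - zseq n‖) atTop (𝓝 0) :=
    hvanish _ h12 _ fun n => by
      linarith [hstep p₀ hp₀ n, mul_nonneg h13.le (sq_nonneg ‖xseq n - T n (xseq n)‖)]
  have hxT : Tendsto (fun n => ‖xseq n - T n (xseq n)‖) atTop (𝓝 0) :=
    hvanish _ h13 _ fun n => by
      linarith [hstep p₀ hp₀ n, mul_nonneg h12.le (sq_nonneg ‖xseq n - zseq n‖)]
  have hzq : Tendsto zseq atTop (𝓝 q) := by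
    simpa using hq.sub (tendsto_zero_iff_norm_tendsto_zero.2 hxz)
  have hqΓ : q ∈ FΓ := by
    rw [hFΓ]
    refine ⟨hqC, fun S hS => hΓclosed S hS xseq hxC q hqC hq q ?_⟩
    have := hNST xseq hxC (Metric.isBounded_range_of_tendsto _ hq) hxT S hS
    simpa using hq.sub (tendsto_zero_iff_norm_tendsto_zero.2 this)
  have hqEP : ∀ l, q ∈ {p ∈ C | ∀ y ∈ C, 0 ≤ f l p y} := by
    intro l
    rw [hEPdual l]
    refine ⟨hqC, Set.mem_iInter₂.2 fun y hy => ⟨hqC, ?_⟩⟩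
    have hφ : Tendsto (fun k => l.1 + L * k) atTop atTop :=
      tendsto_atTop_mono (fun k => (Nat.le_mul_of_pos_left k hL).trans (Nat.le_add_left _ _))
        tendsto_id
    refine apply_le_zero_of_tendsto_resolvent hCclosed (hA2 l) hy (hA4 l y hy).2 ha
      (r := fun k => rn (l.1 + L * k)) (fun k => hrn _) (fun k => (hzseq _).1) (fun k => ?_)
      (hzq.comp hφ) (hxz.comp hφ)
    have hmod : (⟨(l.1 + L * k) % L, Nat.mod_lt _ hL⟩ : Fin L) = l := by
      ext
      simp [Nat.mod_eq_of_lt l.2]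
    have h := (hzseq (l.1 + L * k)).2 y hy
    rwa [hmod] at h
  refine ⟨⟨hBclosed, hBconv⟩, q, hB ▸ ⟨hqΓ, Set.mem_iInter.2 hqEP⟩, fun w hw => ?_, hq⟩
  exact le_of_tendsto (tendsto_const_nhds.sub hq).norm
    (Eventually.of_forall fun n => hxmin n w (hBsub n hw))
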